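/- arXiv:1307.5923 — 2 statements merged into one kernel-verified Lean document; each statement's English description precedes it below -/
import Mathlib

section
/- If p ∈ ℝ[x,y] is a polynomial of total degree at most n, then for all (x,y) ∈ B₂ one has p(x,y) = Σ_{j=0}^{n} Σ_{k=0}^{j} b_{j,k}·Q_j^k(x,y), where b_{j,k} = ∫_{B₂} p(x,y)·Q_j^k(x,y) dx dy; that is, the family {Q_j^k : 0 ≤ k ≤ j ≤ n} spans the restrictions to B₂ of all polynomials of total degree at most n. -/
open MeasureTheory Real Filter

/-- The Gegenbauer polynomials `C_n^λ`, defined by their triple recursion. -/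
noncomputable def gegenbauer (lam : ℝ) : ℕ → ℝ → ℝ
  | 0, _ => 1
  | 1, t => 2 * lam * t
  | (n + 2), t =>
      (2 * (((n : ℝ) + 1) + lam) / ((n : ℝ) + 2)) * t * gegenbauer lam (n + 1) t
        - ((((n : ℝ) + 1) + 2 * lam - 1) / ((n : ℝ) + 2)) * gegenbauer lam n t

/-- The open unit disk in `ℝ²`. -/
def unitDisk : Set (ℝ × ℝ) := {p | p.1 ^ 2 + p.2 ^ 2 < 1}

/-- The normalization constant `h_{k,n}`. -/
noncomputable def hConst (k n : ℕ) : ℝ :=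
  Real.sqrt ((π / 4 ^ k) * (Nat.factorial (n + k + 1)) /
    (((n : ℝ) + 1) * (2 * (k : ℝ) + 1) * ((Nat.factorial k : ℝ)) ^ 2 *
      (Nat.factorial (n - k) : ℝ)))

/-- The orthonormal polynomial basis `Q_n^k` on the unit disk. -/
noncomputable def Q2 (n k : ℕ) (x y : ℝ) : ℝ :=
  (1 / hConst k n) * gegenbauer ((k : ℝ) + 1) (n - k) x *
    (1 - x ^ 2) ^ ((k : ℝ) / 2) * gegenbauer (1 / 2) k (y / Real.sqrt (1 - x ^ 2))

/-- The Gegenbauer polynomials as elements of `ℝ[X]`. -/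
noncomputable def gegenbauerPoly (lam : ℝ) : ℕ → Polynomial ℝ
  | 0 => 1
  | 1 => Polynomial.C (2 * lam) * Polynomial.X
  | (n + 2) =>
      Polynomial.C (2 * (((n : ℝ) + 1) + lam) / ((n : ℝ) + 2)) * Polynomial.X *
          gegenbauerPoly lam (n + 1)
        - Polynomial.C ((((n : ℝ) + 1) + 2 * lam - 1) / ((n : ℝ) + 2)) * gegenbauerPoly lam n

theorem eval_gegenbauerPoly (lam : ℝ) (n : ℕ) (t : ℝ) :
    (gegenbauerPoly lam n).eval t = gegenbauer lam n t := by
  induction n using Nat.twoStepInduction with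
  | zero => simp [gegenbauerPoly, gegenbauer]
  | one => simp [gegenbauerPoly, gegenbauer]
  | more n ih₀ ih₁ => simp [gegenbauerPoly, gegenbauer, ih₀, ih₁]

theorem gegenbauer_recurrence (lam : ℝ) (n : ℕ) (t : ℝ) :
    2 * ((n : ℝ) + 1 + lam) * (t * gegenbauer lam (n + 1) t) =
      ((n : ℝ) + 2) * gegenbauer lam (n + 2) t + ((n : ℝ) + 2 * lam) * gegenbauer lam n t := by
  have h : (n : ℝ) + 2 ≠ 0 := by positivity
  simp only [gegenbauer]
  field_simp
  ring

theorem eval_derivative_gegenbauerPoly_add_two (lam : ℝ) (n : ℕ) (t : ℝ) :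
    ((n : ℝ) + 2) * (gegenbauerPoly lam (n + 2)).derivative.eval t =
      2 * ((n : ℝ) + 1 + lam) *
          (gegenbauer lam (n + 1) t + t * (gegenbauerPoly lam (n + 1)).derivative.eval t)
        - ((n : ℝ) + 2 * lam) * (gegenbauerPoly lam n).derivative.eval t := by
  have h : (n : ℝ) + 2 ≠ 0 := by positivity
  simp only [gegenbauerPoly, Polynomial.derivative_sub, Polynomial.derivative_mul,
    Polynomial.derivative_C, Polynomial.derivative_X, Polynomial.eval_sub, Polynomial.eval_mul,
    Polynomial.eval_add, Polynomial.eval_C, Polynomial.eval_X, Polynomial.eval_zero,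
    Polynomial.eval_one, eval_gegenbauerPoly]
  field_simp
  ring

/-- The two first-order differential relations between consecutive Gegenbauer polynomials. -/
theorem gegenbauerPoly_derivative_relations (lam : ℝ) (n : ℕ) :
    (∀ t : ℝ, (gegenbauerPoly lam (n + 1)).derivative.eval t =
        t * (gegenbauerPoly lam n).derivative.eval t + ((n : ℝ) + 2 * lam) * gegenbauer lam n t) ∧
      ∀ t : ℝ, (1 - t ^ 2) * (gegenbauerPoly lam n).derivative.eval t =
        ((n : ℝ) + 2 * lam) * t * gegenbauer lam n t - ((n : ℝ) + 1) * gegenbauer lam (n + 1) t := by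
  induction n with
  | zero =>
    constructor <;> intro t <;> simp [gegenbauerPoly, gegenbauer]
  | succ n ih =>
    obtain ⟨h₁, h₂⟩ := ih
    have h : (n : ℝ) + 2 ≠ 0 := by positivity
    constructor <;> intro t
    · have h₃ := eval_derivative_gegenbauerPoly_add_two lam n t
      apply mul_left_cancel₀ h
      push_cast
      linear_combination h₃ + ((n : ℝ) + 2 * lam) * (t * h₁ t - h₂ t)
    · have h₃ := gegenbauer_recurrence lam n t
      push_cast
      linear_combination h₁ t - t * (t * h₁ t - h₂ t) - h₃

/-- The Gegenbauer differential equation. -/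
theorem gegenbauerPoly_ode (lam : ℝ) (n : ℕ) (t : ℝ) :
    (1 - t ^ 2) * (gegenbauerPoly lam n).derivative.derivative.eval t
        - (2 * lam + 1) * t * (gegenbauerPoly lam n).derivative.eval t =
      -((n : ℝ) * (n + 2 * lam)) * gegenbauer lam n t := by
  have h : (1 - Polynomial.X ^ 2) * (gegenbauerPoly lam n).derivative =
      Polynomial.C ((n : ℝ) + 2 * lam) * Polynomial.X * gegenbauerPoly lam n
        - Polynomial.C ((n : ℝ) + 1) * gegenbauerPoly lam (n + 1) := by
    apply Polynomial.funext
    intro t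
    have := (gegenbauerPoly_derivative_relations lam n).2 t
    simp only [Polynomial.eval_sub, Polynomial.eval_mul, Polynomial.eval_one, Polynomial.eval_pow,
      Polynomial.eval_X, Polynomial.eval_C, eval_gegenbauerPoly]
    linear_combination this
  have h' := congrArg (fun q => q.derivative.eval t) h
  simp only [Polynomial.derivative_sub, Polynomial.derivative_mul, Polynomial.derivative_one,
    Polynomial.derivative_X_pow, Polynomial.derivative_C, Polynomial.derivative_X,
    Polynomial.eval_sub, Polynomial.eval_mul, Polynomial.eval_add, Polynomial.eval_one,
    Polynomial.eval_pow, Polynomial.eval_X, Polynomial.eval_C, Polynomial.eval_zero,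
    eval_gegenbauerPoly] at h'
  have h₁ := (gegenbauerPoly_derivative_relations lam n).1 t
  push_cast at h'
  linear_combination h' - ((n : ℝ) + 1) * h₁

/-- A functional on polynomials obeys the integration by parts rule of the weight
`(1 - x ^ 2) ^ (lam - 1 / 2)`. -/
def IsGegenbauerFunctional (lam : ℝ) (L : Polynomial ℝ →ₗ[ℝ] ℝ) : Prop :=
  ∀ q : Polynomial ℝ, L ((1 - Polynomial.X ^ 2) * q.derivative
    - Polynomial.C (2 * lam + 1) * Polynomial.X * q) = 0

namespace IsGegenbauerFunctional

variable {lam : ℝ} {L : Polynomial ℝ →ₗ[ℝ] ℝ}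

theorem apply_mul_eq (hL : IsGegenbauerFunctional lam L) (m n : ℕ) :
    (n : ℝ) * (n + 2 * lam) * L (gegenbauerPoly lam n * gegenbauerPoly lam m) =
      L ((1 - Polynomial.X ^ 2) * (gegenbauerPoly lam n).derivative *
        (gegenbauerPoly lam m).derivative) := by
  have h := hL ((gegenbauerPoly lam n).derivative * gegenbauerPoly lam m)
  have e : (1 - Polynomial.X ^ 2) *
      ((gegenbauerPoly lam n).derivative * gegenbauerPoly lam m).derivative
      - Polynomial.C (2 * lam + 1) * Polynomial.X *
        ((gegenbauerPoly lam n).derivative * gegenbauerPoly lam m) =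
      (1 - Polynomial.X ^ 2) * (gegenbauerPoly lam n).derivative *
        (gegenbauerPoly lam m).derivative
      - ((n : ℝ) * (n + 2 * lam)) • (gegenbauerPoly lam n * gegenbauerPoly lam m) := by
    apply Polynomial.funext
    intro t
    have := gegenbauerPoly_ode lam n t
    simp only [Polynomial.derivative_mul, Polynomial.eval_sub, Polynomial.eval_mul,
      Polynomial.eval_add, Polynomial.eval_one, Polynomial.eval_pow, Polynomial.eval_X,
      Polynomial.eval_C, Polynomial.eval_smul, smul_eq_mul, eval_gegenbauerPoly]
    linear_combination gegenbauer lam m t * this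
  rw [e, map_sub, map_smul, smul_eq_mul] at h
  linarith

theorem apply_mul_eq_zero (hL : IsGegenbauerFunctional lam L) (hlam : 0 < lam) {m n : ℕ}
    (hmn : m ≠ n) : L (gegenbauerPoly lam n * gegenbauerPoly lam m) = 0 := by
  have h₁ := hL.apply_mul_eq m n
  have h₂ := hL.apply_mul_eq n m
  rw [mul_right_comm (1 - Polynomial.X ^ 2), ← h₁, mul_comm (gegenbauerPoly lam m)] at h₂
  have h₃ : ((m : ℝ) - n) * (m + n + 2 * lam) *
      L (gegenbauerPoly lam n * gegenbauerPoly lam m) = 0 := by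
    linear_combination h₂
  refine (mul_eq_zero.mp h₃).resolve_left (mul_ne_zero ?_ (by positivity))
  exact sub_ne_zero.mpr (Nat.cast_injective.ne hmn)

theorem apply_sq_succ (hL : IsGegenbauerFunctional lam L) (hlam : 0 < lam) (n : ℕ) :
    ((n : ℝ) + 1) * (n + 1 + lam) *
        L (gegenbauerPoly lam (n + 1) * gegenbauerPoly lam (n + 1)) =
      ((n : ℝ) + lam) * (n + 2 * lam) * L (gegenbauerPoly lam n * gegenbauerPoly lam n) := by
  have key : ∀ i : ℕ, (2 * ((i : ℝ) + 1 + lam)) •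
      (Polynomial.X * gegenbauerPoly lam (i + 1)) =
      ((i : ℝ) + 2) • gegenbauerPoly lam (i + 2) + ((i : ℝ) + 2 * lam) • gegenbauerPoly lam i := by
    intro i
    apply Polynomial.funext
    intro t
    simp only [Polynomial.eval_smul, Polynomial.eval_add, Polynomial.eval_mul, Polynomial.eval_X,
      smul_eq_mul, eval_gegenbauerPoly]
    exact gegenbauer_recurrence lam i t
  have up : 2 * ((n : ℝ) + 1 + lam) *
      L (Polynomial.X * gegenbauerPoly lam (n + 1) * gegenbauerPoly lam n) =
      ((n : ℝ) + 2 * lam) * L (gegenbauerPoly lam n * gegenbauerPoly lam n) := by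
    have h := congrArg (fun q => L (q * gegenbauerPoly lam n)) (key n)
    simpa [add_mul, hL.apply_mul_eq_zero hlam (show n ≠ n + 2 by omega)] using h
  have down : 2 * ((n : ℝ) + lam) *
      L (Polynomial.X * gegenbauerPoly lam n * gegenbauerPoly lam (n + 1)) =
      ((n : ℝ) + 1) * L (gegenbauerPoly lam (n + 1) * gegenbauerPoly lam (n + 1)) := by
    cases n with
    | zero =>
      have e : (2 * lam) • (Polynomial.X * gegenbauerPoly lam 0) = gegenbauerPoly lam 1 := by
        simp [gegenbauerPoly, Polynomial.smul_eq_C_mul]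
      have h := congrArg (fun q => L (q * gegenbauerPoly lam 1)) e
      simpa using h
    | succ i =>
      have h := congrArg (fun q => L (q * gegenbauerPoly lam (i + 2))) (key i)
      have h₂ := hL.apply_mul_eq_zero hlam (show i + 2 ≠ i by omega)
      simp only [smul_mul_assoc, add_mul, map_add, map_smul, smul_eq_mul, h₂] at h
      push_cast
      linear_combination h
  rw [mul_right_comm Polynomial.X] at down
  linear_combination ((n : ℝ) + lam) * up - ((n : ℝ) + 1 + lam) * down

end IsGegenbauerFunctional

/-- Integration of polynomials over `[-1, 1]` against the weight `√(1 - x ^ 2) ^ e`. -/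
noncomputable def weightFunctional (e : ℕ) : Polynomial ℝ →ₗ[ℝ] ℝ where
  toFun q := ∫ x in (-1 : ℝ)..1, q.eval x * √(1 - x ^ 2) ^ e
  map_add' p q := by
    simp only [Polynomial.eval_add, add_mul]
    apply intervalIntegral.integral_add <;>
      exact Continuous.intervalIntegrable (by fun_prop) _ _
  map_smul' c q := by
    simp only [Polynomial.eval_smul, smul_eq_mul, mul_assoc, RingHom.id_apply]
    exact intervalIntegral.integral_const_mul _ _

theorem weightFunctional_apply (e : ℕ) (q : Polynomial ℝ) :
    weightFunctional e q = ∫ x in (-1 : ℝ)..1, q.eval x * √(1 - x ^ 2) ^ e :=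
  rfl

theorem isGegenbauerFunctional_weightFunctional (e : ℕ) :
    IsGegenbauerFunctional (((e : ℝ) + 1) / 2) (weightFunctional e) := by
  intro q
  rw [weightFunctional_apply]
  have h := intervalIntegral.integral_eq_sub_of_hasDerivAt_of_le (a := -1) (b := 1)
    (f := fun x : ℝ => √(1 - x ^ 2) ^ (e + 2) * q.eval x)
    (f' := fun x : ℝ => ((1 - Polynomial.X ^ 2) * q.derivative
      - Polynomial.C (2 * (((e : ℝ) + 1) / 2) + 1) * Polynomial.X * q).eval x *
        √(1 - x ^ 2) ^ e) (by norm_num) (by fun_prop) ?_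
      (Continuous.intervalIntegrable (by fun_prop) _ _)
  · rw [h]
    simp
  · intro x hx
    have hpos : 0 < 1 - x ^ 2 := by nlinarith [hx.1, hx.2]
    have hs : √(1 - x ^ 2) ≠ 0 := (Real.sqrt_pos.mpr hpos).ne'
    have hsq : √(1 - x ^ 2) ^ 2 = 1 - x ^ 2 := Real.sq_sqrt hpos.le
    have hd : HasDerivAt (fun x : ℝ => 1 - x ^ 2) (-(2 * x)) x := by
      simpa using (hasDerivAt_pow 2 x).const_sub 1
    refine (((hd.sqrt hpos.ne').fun_pow (e + 2)).mul (q.hasDerivAt x)).congr_deriv ?_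
    simp only [Polynomial.eval_sub, Polynomial.eval_mul, Polynomial.eval_one, Polynomial.eval_pow,
      Polynomial.eval_X, Polynomial.eval_C]
    rw [show e + 2 - 1 = e + 1 by omega]
    generalize √(1 - x ^ 2) = s at hs hsq ⊢
    rw [← hsq]
    push_cast
    field_simp
    ring

theorem weightFunctional_one_add_two (e : ℕ) :
    ((e : ℝ) + 3) * weightFunctional (e + 2) 1 = ((e : ℝ) + 2) * weightFunctional e 1 := by
  have h := isGegenbauerFunctional_weightFunctional e Polynomial.X
  have h₂ : weightFunctional (e + 2) 1 = weightFunctional e (1 - Polynomial.X ^ 2) := by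
    simp only [weightFunctional_apply]
    apply intervalIntegral.integral_congr
    intro x hx
    rw [Set.uIcc_of_le (by norm_num)] at hx
    have hpos : 0 ≤ 1 - x ^ 2 := by nlinarith [hx.1, hx.2]
    simp [pow_add, Real.sq_sqrt hpos, mul_comm]
  have h₃ : (1 - Polynomial.X ^ 2) * (Polynomial.X : Polynomial ℝ).derivative
      - Polynomial.C (2 * (((e : ℝ) + 1) / 2) + 1) * Polynomial.X * Polynomial.X =
      ((e : ℝ) + 3) • (1 - Polynomial.X ^ 2) - ((e : ℝ) + 2) • (1 : Polynomial ℝ) := by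
    apply Polynomial.funext
    intro t
    simp
    ring
  rw [h₃, map_sub, map_smul, map_smul, ← h₂, smul_eq_mul, smul_eq_mul] at h
  linarith

theorem weightFunctional_odd_one (k : ℕ) :
    weightFunctional (2 * k + 1) 1 =
      π / 2 * (2 * k + 1).factorial / (4 ^ k * ((k : ℝ) + 1) * (k.factorial : ℝ) ^ 2) := by
  induction k with
  | zero => simp [weightFunctional_apply, integral_sqrt_one_sub_sq]
  | succ k ih =>
    have h := weightFunctional_one_add_two (2 * k + 1)
    rw [ih] at h
    have h₃ : ((2 * k + 1 : ℕ) : ℝ) + 3 ≠ 0 := by positivity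
    apply mul_left_cancel₀ h₃
    rw [show 2 * (k + 1) + 1 = 2 * k + 1 + 2 by ring, h,
      show 2 * k + 1 + 2 = (2 * k + 1 + 1) + 1 by ring, Nat.factorial_succ (2 * k + 1 + 1),
      Nat.factorial_succ (2 * k + 1), Nat.factorial_succ k]
    have := Nat.factorial_ne_zero k
    push_cast
    field_simp
    ring

theorem weightFunctional_gegenbauerPoly_sq (k m : ℕ) :
    weightFunctional (2 * k + 1)
        (gegenbauerPoly ((k : ℝ) + 1) m * gegenbauerPoly ((k : ℝ) + 1) m) =
      π / 2 * (m + 2 * k + 1).factorial /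
        (4 ^ k * ((m : ℝ) + k + 1) * (k.factorial : ℝ) ^ 2 * m.factorial) := by
  induction m with
  | zero => simpa [gegenbauerPoly] using weightFunctional_odd_one k
  | succ m ih =>
    have hL := isGegenbauerFunctional_weightFunctional (2 * k + 1)
    rw [show (((2 * k + 1 : ℕ) : ℝ) + 1) / 2 = (k : ℝ) + 1 by push_cast; ring] at hL
    have h := hL.apply_sq_succ (by positivity) m
    rw [ih] at h
    have h₀ : ((m : ℝ) + 1) * (m + 1 + (k + 1)) ≠ 0 := by positivity
    apply mul_left_cancel₀ h₀
    rw [h, show m + 1 + 2 * k + 1 = (m + 2 * k + 1) + 1 by ring,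
      Nat.factorial_succ (m + 2 * k + 1), Nat.factorial_succ m]
    have := Nat.factorial_ne_zero k
    have := Nat.factorial_ne_zero m
    push_cast
    field_simp
    ring

theorem weightFunctional_legendre_sq (k : ℕ) :
    weightFunctional 0 (gegenbauerPoly (1 / 2) k * gegenbauerPoly (1 / 2) k) =
      2 / (2 * (k : ℝ) + 1) := by
  induction k with
  | zero => norm_num [gegenbauerPoly, weightFunctional_apply]
  | succ k ih =>
    have hL := isGegenbauerFunctional_weightFunctional 0
    rw [Nat.cast_zero, zero_add] at hL
    have h := hL.apply_sq_succ (by positivity) k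
    rw [ih] at h
    have h₀ : ((k : ℝ) + 1) * (k + 1 + 1 / 2) ≠ 0 := by positivity
    apply mul_left_cancel₀ h₀
    rw [h]
    push_cast
    field_simp

theorem weightFunctional_legendre_of_ne {k l : ℕ} (h : k ≠ l) :
    weightFunctional 0 (gegenbauerPoly (1 / 2) k * gegenbauerPoly (1 / 2) l) = 0 := by
  have hL := isGegenbauerFunctional_weightFunctional 0
  rw [Nat.cast_zero, zero_add] at hL
  exact hL.apply_mul_eq_zero (by positivity) h.symm

theorem weightFunctional_gegenbauerPoly_of_ne (k : ℕ) {m m' : ℕ} (h : m ≠ m') :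
    weightFunctional (2 * k + 1)
      (gegenbauerPoly ((k : ℝ) + 1) m * gegenbauerPoly ((k : ℝ) + 1) m') = 0 := by
  have hL := isGegenbauerFunctional_weightFunctional (2 * k + 1)
  rw [show (((2 * k + 1 : ℕ) : ℝ) + 1) / 2 = (k : ℝ) + 1 by push_cast; ring] at hL
  exact hL.apply_mul_eq_zero (by positivity) h.symm

/-- The polynomial `(1 - x ^ 2) ^ (k / 2) * C_k^{1/2}(y / √(1 - x ^ 2))`. -/
noncomputable def homLegendre : ℕ → ℝ × ℝ → ℝ
  | 0, _ => 1
  | 1, q => q.2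
  | (k + 2), q =>
      (2 * (k : ℝ) + 3) / ((k : ℝ) + 2) * q.2 * homLegendre (k + 1) q
        - ((k : ℝ) + 1) / ((k : ℝ) + 2) * (1 - q.1 ^ 2) * homLegendre k q

theorem homLegendre_eq {x s : ℝ} (hs : s ^ 2 = 1 - x ^ 2) (k : ℕ) (t : ℝ) :
    homLegendre k (x, s * t) = s ^ k * gegenbauer (1 / 2) k t := by
  induction k using Nat.twoStepInduction with
  | zero => simp [homLegendre, gegenbauer]
  | one => simp [homLegendre, gegenbauer]
  | more k ih₀ ih₁ =>
    simp only [homLegendre, gegenbauer, ih₀, ih₁, ← hs]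
    field_simp
    ring

theorem homLegendre_recurrence (k : ℕ) (q : ℝ × ℝ) :
    (2 * (k : ℝ) + 3) * (q.2 * homLegendre (k + 1) q) =
      ((k : ℝ) + 2) * homLegendre (k + 2) q +
        ((k : ℝ) + 1) * ((1 - q.1 ^ 2) * homLegendre k q) := by
  simp only [homLegendre]
  field_simp
  ring

theorem continuous_homLegendre (k : ℕ) : Continuous (homLegendre k) := by
  induction k using Nat.twoStepInduction with
  | zero => exact continuous_const
  | one => exact continuous_snd
  | more k ih₀ ih₁ =>
    change Continuous fun q : ℝ × ℝ => _ / _ * q.2 * homLegendre (k + 1) q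
      - _ / _ * (1 - q.1 ^ 2) * homLegendre k q
    fun_prop

theorem continuous_gegenbauer (lam : ℝ) (n : ℕ) : Continuous (gegenbauer lam n) := by
  simpa only [eval_gegenbauerPoly] using (gegenbauerPoly lam n).continuous

/-- The unnormalized basis function `C_m^{k+1}(x) (1 - x ^ 2) ^ (k / 2) C_k^{1/2}(y / √(1 - x ^ 2))`
of degree `m + k`. -/
noncomputable def diskBasis (m k : ℕ) (q : ℝ × ℝ) : ℝ :=
  gegenbauer ((k : ℝ) + 1) m q.1 * homLegendre k q

theorem continuous_diskBasis (m k : ℕ) : Continuous (diskBasis m k) :=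
  ((continuous_gegenbauer _ m).comp continuous_fst).mul (continuous_homLegendre k)

theorem Q2_eq_diskBasis (n k : ℕ) {q : ℝ × ℝ} (hq : q ∈ unitDisk) :
    Q2 n k q.1 q.2 = 1 / hConst k n * diskBasis (n - k) k q := by
  have hpos : 0 < 1 - q.1 ^ 2 := by
    have : q.1 ^ 2 + q.2 ^ 2 < 1 := hq
    nlinarith [sq_nonneg q.2]
  have hs : √(1 - q.1 ^ 2) ≠ 0 := (Real.sqrt_pos.mpr hpos).ne'
  have h := homLegendre_eq (Real.sq_sqrt hpos.le) k (q.2 / √(1 - q.1 ^ 2))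
  rw [mul_div_cancel₀ _ hs] at h
  have hp : (1 - q.1 ^ 2) ^ ((k : ℝ) / 2) = √(1 - q.1 ^ 2) ^ k := by
    rw [Real.sqrt_eq_rpow, ← Real.rpow_mul_natCast hpos.le]
    ring_nf
  rw [Q2, diskBasis, show homLegendre k q = _ from h, hp]
  ring

theorem isOpen_unitDisk : IsOpen unitDisk :=
  isOpen_lt (by fun_prop) continuous_const

theorem integrableOn_unitDisk {f : ℝ × ℝ → ℝ} (hf : Continuous f) : IntegrableOn f unitDisk := by
  refine (hf.continuousOn.integrableOn_compact
    ((isCompact_Icc (a := (-1 : ℝ)) (b := 1)).prod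
      (isCompact_Icc (a := (-1 : ℝ)) (b := 1)))).mono_set ?_
  intro q hq
  have : q.1 ^ 2 + q.2 ^ 2 < 1 := hq
  refine ⟨⟨?_, ?_⟩, ?_, ?_⟩ <;> nlinarith [sq_nonneg q.1, sq_nonneg q.2]

theorem setIntegral_unitDisk {f : ℝ × ℝ → ℝ} (hf : Continuous f) :
    ∫ q in unitDisk, f q =
      ∫ x in (-1 : ℝ)..1, √(1 - x ^ 2) * ∫ t in (-1 : ℝ)..1, f (x, √(1 - x ^ 2) * t) := by
  have hm : MeasurableSet unitDisk := isOpen_unitDisk.measurableSet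
  rw [← integral_indicator hm, Measure.volume_eq_prod, integral_prod _
    ((integrable_indicator_iff hm).mpr (integrableOn_unitDisk hf)),
    intervalIntegral.integral_of_le (by norm_num), integral_Ioc_eq_integral_Ioo,
    ← integral_indicator measurableSet_Ioo]
  congr 1
  ext x
  by_cases hx : x ∈ Set.Ioo (-1 : ℝ) 1
  · have hpos : 0 < 1 - x ^ 2 := by nlinarith [hx.1, hx.2]
    have h : (fun y => unitDisk.indicator f (x, y)) =
        (Set.Ioo (-√(1 - x ^ 2)) √(1 - x ^ 2)).indicator fun y => f (x, y) := by
      ext y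
      have : (x, y) ∈ unitDisk ↔ y ∈ Set.Ioo (-√(1 - x ^ 2)) √(1 - x ^ 2) := by
        rw [Set.mem_Ioo, ← Real.sq_lt, unitDisk, Set.mem_ofPred_eq, lt_sub_iff_add_lt']
      by_cases hy : (x, y) ∈ unitDisk
      · rw [Set.indicator_of_mem hy, Set.indicator_of_mem (this.mp hy)]
      · rw [Set.indicator_of_notMem hy, Set.indicator_of_notMem (mt this.mpr hy)]
    rw [Set.indicator_of_mem hx, h, integral_indicator measurableSet_Ioo,
      ← integral_Ioc_eq_integral_Ioo, ← intervalIntegral.integral_of_le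
        (by linarith [Real.sqrt_nonneg (1 - x ^ 2)]),
      intervalIntegral.mul_integral_comp_mul_left (f := fun y => f (x, y))]
    simp
  · rw [Set.indicator_of_notMem hx]
    have h : (fun y => unitDisk.indicator f (x, y)) = 0 := by
      ext y
      apply Set.indicator_of_notMem
      intro hy
      have : x ^ 2 + y ^ 2 < 1 := hy
      exact hx ⟨by nlinarith [sq_nonneg y], by nlinarith [sq_nonneg y]⟩
    rw [h]
    simp

theorem integral_diskBasis_mul (m k m' k' : ℕ) :
    ∫ q in unitDisk, diskBasis m k q * diskBasis m' k' q =
      weightFunctional (k + k' + 1)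
          (gegenbauerPoly ((k : ℝ) + 1) m * gegenbauerPoly ((k' : ℝ) + 1) m') *
        weightFunctional 0 (gegenbauerPoly (1 / 2) k * gegenbauerPoly (1 / 2) k') := by
  have hc : Continuous fun q => diskBasis m k q * diskBasis m' k' q :=
    (continuous_diskBasis m k).mul (continuous_diskBasis m' k')
  rw [setIntegral_unitDisk hc,
    weightFunctional_apply (k + k' + 1), ← intervalIntegral.integral_mul_const]
  apply intervalIntegral.integral_congr
  intro x hx
  rw [Set.uIcc_of_le (by norm_num)] at hx
  have hpos : 0 ≤ 1 - x ^ 2 := by nlinarith [hx.1, hx.2]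
  simp only [diskBasis, homLegendre_eq (Real.sq_sqrt hpos), weightFunctional_apply,
    Polynomial.eval_mul, eval_gegenbauerPoly, pow_zero, mul_one]
  rw [← intervalIntegral.integral_const_mul, ← intervalIntegral.integral_const_mul]
  congr 1
  ext t
  ring

theorem hConst_sq (m k : ℕ) :
    hConst k (m + k) ^ 2 = weightFunctional (2 * k + 1)
        (gegenbauerPoly ((k : ℝ) + 1) m * gegenbauerPoly ((k : ℝ) + 1) m) *
      weightFunctional 0 (gegenbauerPoly (1 / 2) k * gegenbauerPoly (1 / 2) k) := by
  rw [hConst, Real.sq_sqrt (by positivity), weightFunctional_gegenbauerPoly_sq,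
    weightFunctional_legendre_sq, Nat.add_sub_cancel, show m + k + k + 1 = m + 2 * k + 1 by ring]
  push_cast
  field_simp

theorem hConst_pos (k n : ℕ) : 0 < hConst k n :=
  Real.sqrt_pos.mpr (by positivity)

theorem integral_diskBasis_sq (m k : ℕ) :
    ∫ q in unitDisk, diskBasis m k q * diskBasis m k q = hConst k (m + k) ^ 2 := by
  rw [integral_diskBasis_mul, hConst_sq, two_mul]

theorem integral_diskBasis_mul_of_ne {m k m' k' : ℕ} (h : ¬(m = m' ∧ k = k')) :
    ∫ q in unitDisk, diskBasis m k q * diskBasis m' k' q = 0 := by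
  rw [integral_diskBasis_mul]
  by_cases hk : k = k'
  · subst hk
    rw [← two_mul, weightFunctional_gegenbauerPoly_of_ne k (fun hm => h ⟨hm, rfl⟩), zero_mul]
  · rw [weightFunctional_legendre_of_ne hk, mul_zero]

/-- The Fourier coefficient of `f` along `Q_j^k`. -/
noncomputable def fourierCoeffQ2 (f : ℝ × ℝ → ℝ) (j k : ℕ) : ℝ :=
  ∫ q in unitDisk, f q * Q2 j k q.1 q.2

theorem fourierCoeffQ2_eq (f : ℝ × ℝ → ℝ) (j k : ℕ) :
    fourierCoeffQ2 f j k = 1 / hConst k j * ∫ q in unitDisk, f q * diskBasis (j - k) k q := by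
  rw [fourierCoeffQ2, ← integral_const_mul]
  apply setIntegral_congr_fun isOpen_unitDisk.measurableSet
  intro q hq
  simp only [Q2_eq_diskBasis j k hq]
  ring

theorem fourierCoeffQ2_add {f g : ℝ × ℝ → ℝ} (hf : Continuous f) (hg : Continuous g) (j k : ℕ) :
    fourierCoeffQ2 (f + g) j k = fourierCoeffQ2 f j k + fourierCoeffQ2 g j k := by
  have hB := continuous_diskBasis (j - k) k
  simp only [fourierCoeffQ2_eq, Pi.add_apply, add_mul]
  rw [integral_add (integrableOn_unitDisk (by fun_prop)) (integrableOn_unitDisk (by fun_prop)),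
    mul_add]

theorem fourierCoeffQ2_smul (c : ℝ) (f : ℝ × ℝ → ℝ) (j k : ℕ) :
    fourierCoeffQ2 (c • f) j k = c * fourierCoeffQ2 f j k := by
  simp only [fourierCoeffQ2, Pi.smul_apply, smul_eq_mul, mul_assoc, integral_const_mul]

theorem fourierCoeffQ2_diskBasis_self (m k : ℕ) :
    fourierCoeffQ2 (diskBasis m k) (m + k) k = hConst k (m + k) := by
  have := (hConst_pos k (m + k)).ne'
  rw [fourierCoeffQ2_eq, Nat.add_sub_cancel, integral_diskBasis_sq]
  field_simp

theorem fourierCoeffQ2_diskBasis_of_ne {m k j k' : ℕ} (h : ¬(m = j - k' ∧ k = k')) :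
    fourierCoeffQ2 (diskBasis m k) j k' = 0 := by
  rw [fourierCoeffQ2_eq, integral_diskBasis_mul_of_ne h, mul_zero]

/-- The span of the basis functions of degree at most `n`. -/
noncomputable def diskSpan (n : ℕ) : Submodule ℝ (ℝ × ℝ → ℝ) :=
  Submodule.span ℝ {f | ∃ m k, m + k ≤ n ∧ f = diskBasis m k}

theorem diskBasis_mem_diskSpan {m k n : ℕ} (h : m + k ≤ n) : diskBasis m k ∈ diskSpan n :=
  Submodule.subset_span ⟨m, k, h, rfl⟩

theorem diskSpan_mono : Monotone diskSpan := fun _ _ hab =>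
  Submodule.span_mono fun _ ⟨m, k, h, hf⟩ => ⟨m, k, h.trans hab, hf⟩

theorem continuous_and_eq_sum_of_mem_diskSpan {n : ℕ} {f : ℝ × ℝ → ℝ} (hf : f ∈ diskSpan n) :
    Continuous f ∧ ∀ q ∈ unitDisk, f q = ∑ j ∈ Finset.range (n + 1), ∑ k ∈ Finset.range (j + 1),
      fourierCoeffQ2 f j k * Q2 j k q.1 q.2 := by
  induction hf using Submodule.span_induction with
  | mem f hf =>
    obtain ⟨m, k, hmk, rfl⟩ := hf
    refine ⟨continuous_diskBasis m k, fun q hq => ?_⟩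
    rw [Finset.sum_eq_single (m + k), Finset.sum_eq_single k, fourierCoeffQ2_diskBasis_self,
      Q2_eq_diskBasis _ _ hq, Nat.add_sub_cancel, ← mul_assoc,
      mul_one_div_cancel (hConst_pos k (m + k)).ne', one_mul]
    · intro k' _ hk'
      rw [fourierCoeffQ2_diskBasis_of_ne (by omega), zero_mul]
    · intro hk
      simp at hk
    · intro j _ hj
      refine Finset.sum_eq_zero fun k' hk' => ?_
      rw [Finset.mem_range] at hk'
      rw [fourierCoeffQ2_diskBasis_of_ne (by omega), zero_mul]
    · intro hj
      simp at hj
      omega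
  | zero =>
    exact ⟨continuous_zero, fun q _ => by simp [fourierCoeffQ2]⟩
  | add f g _ _ hf hg =>
    refine ⟨hf.1.add hg.1, fun q hq => ?_⟩
    simp only [fourierCoeffQ2_add hf.1 hg.1, add_mul, Finset.sum_add_distrib, Pi.add_apply]
    rw [← hf.2 q hq, ← hg.2 q hq]
  | smul c f _ hf =>
    refine ⟨hf.1.const_smul c, fun q hq => ?_⟩
    simp only [fourierCoeffQ2_smul, mul_assoc, ← Finset.mul_sum, Pi.smul_apply, smul_eq_mul]
    rw [← hf.2 q hq]

theorem fst_mul_mem_diskSpan {n : ℕ} {f : ℝ × ℝ → ℝ} (hf : f ∈ diskSpan n) :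
    Prod.fst * f ∈ diskSpan (n + 1) := by
  induction hf using Submodule.span_induction with
  | mem f hf =>
    obtain ⟨m, k, hmk, rfl⟩ := hf
    cases m with
    | zero =>
      have h : Prod.fst * diskBasis 0 k = (1 / (2 * ((k : ℝ) + 1))) • diskBasis 1 k := by
        ext q
        simp only [diskBasis, gegenbauer, Pi.mul_apply, Pi.smul_apply, smul_eq_mul]
        field_simp
      rw [h]
      exact Submodule.smul_mem _ _ (diskBasis_mem_diskSpan (by omega))
    | succ m =>
      have h : Prod.fst * diskBasis (m + 1) k = (1 / (2 * ((m : ℝ) + 1 + (k + 1)))) •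
          (((m : ℝ) + 2) • diskBasis (m + 2) k + ((m : ℝ) + 2 * (k + 1)) • diskBasis m k) := by
        ext q
        have := gegenbauer_recurrence ((k : ℝ) + 1) m q.1
        simp only [diskBasis, Pi.mul_apply, Pi.smul_apply, Pi.add_apply, smul_eq_mul]
        rw [one_div, eq_inv_mul_iff_mul_eq₀ (by positivity)]
        linear_combination homLegendre k q * this
      rw [h]
      exact Submodule.smul_mem _ _ (Submodule.add_mem _
        (Submodule.smul_mem _ _ (diskBasis_mem_diskSpan (by omega)))
        (Submodule.smul_mem _ _ (diskBasis_mem_diskSpan (by omega))))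
  | zero => simp
  | add f g _ _ hf hg =>
    rw [mul_add]
    exact Submodule.add_mem _ hf hg
  | smul c f _ hf =>
    rw [mul_smul_comm]
    exact Submodule.smul_mem _ _ hf

/-- The span of the functions `x ^ m * homLegendre k` of degree at most `n`. -/
noncomputable def homLegendreSpan (n : ℕ) : Submodule ℝ (ℝ × ℝ → ℝ) :=
  Submodule.span ℝ {f | ∃ m k, m + k ≤ n ∧ f = Prod.fst ^ m * homLegendre k}

theorem homLegendreSpan_le_diskSpan (n : ℕ) : homLegendreSpan n ≤ diskSpan n := by
  refine Submodule.span_le.mpr ?_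
  rintro f ⟨m, k, hmk, rfl⟩
  refine diskSpan_mono hmk ?_
  clear hmk
  induction m with
  | zero =>
    have : Prod.fst ^ 0 * homLegendre k = diskBasis 0 k := by
      ext q
      simp [diskBasis, gegenbauer]
    rw [this]
    exact diskBasis_mem_diskSpan le_rfl
  | succ m ih =>
    rw [pow_succ', mul_assoc, add_right_comm]
    exact fst_mul_mem_diskSpan ih

theorem pow_mul_homLegendre_mem {m k n : ℕ} (h : m + k ≤ n) :
    Prod.fst ^ m * homLegendre k ∈ homLegendreSpan n :=
  Submodule.subset_span ⟨m, k, h, rfl⟩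

theorem snd_mul_mem_homLegendreSpan {n : ℕ} {f : ℝ × ℝ → ℝ} (hf : f ∈ homLegendreSpan n) :
    Prod.snd * f ∈ homLegendreSpan (n + 1) := by
  induction hf using Submodule.span_induction with
  | mem f hf =>
    obtain ⟨m, k, hmk, rfl⟩ := hf
    cases k with
    | zero =>
      have h : Prod.snd * (Prod.fst ^ m * homLegendre 0) = Prod.fst ^ m * homLegendre 1 := by
        ext q
        simp [homLegendre, mul_comm]
      rw [h]
      exact pow_mul_homLegendre_mem (by omega)
    | succ k =>
      have h : Prod.snd * (Prod.fst ^ m * homLegendre (k + 1)) =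
          (1 / (2 * (k : ℝ) + 3)) • (((k : ℝ) + 2) • (Prod.fst ^ m * homLegendre (k + 2)) +
            ((k : ℝ) + 1) • (Prod.fst ^ m * homLegendre k
              - Prod.fst ^ (m + 2) * homLegendre k)) := by
        ext q
        have := homLegendre_recurrence k q
        simp only [Pi.mul_apply, Pi.smul_apply, Pi.add_apply, Pi.sub_apply, Pi.pow_apply,
          smul_eq_mul]
        rw [one_div, eq_inv_mul_iff_mul_eq₀ (by positivity)]
        linear_combination q.1 ^ m * this
      rw [h]
      exact Submodule.smul_mem _ _ (Submodule.add_mem _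
        (Submodule.smul_mem _ _ (pow_mul_homLegendre_mem (by omega)))
        (Submodule.smul_mem _ _ (Submodule.sub_mem _ (pow_mul_homLegendre_mem (by omega))
          (pow_mul_homLegendre_mem (by omega)))))
  | zero => simp
  | add f g _ _ hf hg =>
    rw [mul_add]
    exact Submodule.add_mem _ hf hg
  | smul c f _ hf =>
    rw [mul_smul_comm]
    exact Submodule.smul_mem _ _ hf

theorem snd_pow_mem_homLegendreSpan (b : ℕ) :
    (Prod.snd ^ b : ℝ × ℝ → ℝ) ∈ homLegendreSpan b := by
  induction b with
  | zero =>
    have : (Prod.snd ^ 0 : ℝ × ℝ → ℝ) = Prod.fst ^ 0 * homLegendre 0 := by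
      ext q
      simp [homLegendre]
    rw [this]
    exact pow_mul_homLegendre_mem le_rfl
  | succ b ih =>
    rw [pow_succ']
    exact snd_mul_mem_homLegendreSpan ih

theorem monomial_mem_diskSpan (a b : ℕ) :
    (Prod.fst ^ a * Prod.snd ^ b : ℝ × ℝ → ℝ) ∈ diskSpan (a + b) := by
  induction a with
  | zero =>
    rw [pow_zero, one_mul, zero_add]
    exact homLegendreSpan_le_diskSpan b (snd_pow_mem_homLegendreSpan b)
  | succ a ih =>
    rw [pow_succ', mul_assoc, add_right_comm]
    exact fst_mul_mem_diskSpan ih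

theorem eval_mem_diskSpan {n : ℕ} {p : MvPolynomial (Fin 2) ℝ} (hp : p.totalDegree ≤ n) :
    (fun q : ℝ × ℝ => MvPolynomial.eval ![q.1, q.2] p) ∈ diskSpan n := by
  have h : (fun q : ℝ × ℝ => MvPolynomial.eval ![q.1, q.2] p) =
      ∑ d ∈ p.support, p.coeff d • (Prod.fst ^ d 0 * Prod.snd ^ d 1) := by
    ext q
    simp [MvPolynomial.eval_eq', Finset.sum_apply]
  rw [h]
  refine Submodule.sum_mem _ fun d hd => Submodule.smul_mem _ _ ?_
  refine diskSpan_mono (le_trans ?_ hp) (monomial_mem_diskSpan (d 0) (d 1))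
  have := MvPolynomial.le_totalDegree hd
  rwa [Finsupp.sum_fintype _ _ (fun _ => rfl), Fin.sum_univ_two] at this

/-- every polynomial of total degree at most `n` is the sum of its
Fourier expansion in the basis `{Q_j^k : 0 ≤ k ≤ j ≤ n}` on the unit disk. -/
theorem poly_eq_fourier_sum (n : ℕ) (p : MvPolynomial (Fin 2) ℝ)
    (hp : p.totalDegree ≤ n) :
    ∀ x y : ℝ, (x, y) ∈ unitDisk →
      MvPolynomial.eval ![x, y] p =
        ∑ j ∈ Finset.range (n + 1), ∑ k ∈ Finset.range (j + 1),
          (∫ q in unitDisk, MvPolynomial.eval ![q.1, q.2] p * Q2 j k q.1 q.2) *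
            Q2 j k x y := by
  intro x y hxy
  exact (continuous_and_eq_sum_of_mem_diskSpan (eval_mem_diskSpan hp)).2 (x, y) hxy
end

section
/- For every integer n ≥ 0 and all integers 0 ≤ i, j ≤ n: ∫_{B₂} x·Q_n^i(x,y)·Q_n^j(x,y) dx dy = 0 and ∫_{B₂} y·Q_n^i(x,y)·Q_n^j(x,y) dx dy = 0 (i.e., the matrices B_{n,1} and B_{n,2} in the general triple recursion relation vanish for this basis). -/
open MeasureTheory Real Filter

theorem gegenbauer_neg (lam : ℝ) (n : ℕ) (t : ℝ) :
    gegenbauer lam n (-t) = (-1) ^ n * gegenbauer lam n t := by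
  induction n using Nat.twoStepInduction with
  | zero => simp [gegenbauer]
  | one => simp [gegenbauer]
  | more n ih₀ ih₁ =>
    rw [gegenbauer, gegenbauer, ih₀, ih₁]
    ring

theorem Q2_neg_neg {n k : ℕ} (hk : k ≤ n) (x y : ℝ) :
    Q2 n k (-x) (-y) = (-1) ^ n * Q2 n k x y := by
  have hsign : (-1 : ℝ) ^ n = (-1) ^ (n - k) * (-1) ^ k := by
    rw [← pow_add, Nat.sub_add_cancel hk]
  simp only [Q2, neg_sq, neg_div, gegenbauer_neg, hsign]
  ring

theorem Q2_mul_Q2_neg_neg {n i j : ℕ} (hi : i ≤ n) (hj : j ≤ n) (x y : ℝ) :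
    Q2 n i (-x) (-y) * Q2 n j (-x) (-y) = Q2 n i x y * Q2 n j x y := by
  have hsq : ((-1 : ℝ) ^ n) * (-1) ^ n = 1 := by
    rw [← mul_pow]; norm_num
  rw [Q2_neg_neg hi, Q2_neg_neg hj, mul_mul_mul_comm, hsq, one_mul]

theorem measurableSet_unitDisk : MeasurableSet unitDisk :=
  (isOpen_lt (by fun_prop) continuous_const).measurableSet

/-- The integral over the disk of a function odd under the point reflection vanishes. -/
theorem setIntegral_unitDisk_eq_zero_of_odd {f : ℝ × ℝ → ℝ} (hf : ∀ p, f (-p) = -f p) :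
    ∫ p in unitDisk, f p = 0 := by
  rw [← integral_indicator measurableSet_unitDisk]
  have hodd : ∀ p, unitDisk.indicator f (-p) = -unitDisk.indicator f p := by
    intro p
    by_cases hp : p ∈ unitDisk
    · have hp' : -p ∈ unitDisk := by simpa [unitDisk] using hp
      rw [Set.indicator_of_mem hp, Set.indicator_of_mem hp', hf]
    · have hp' : -p ∉ unitDisk := by simpa [unitDisk] using hp
      rw [Set.indicator_of_notMem hp, Set.indicator_of_notMem hp', neg_zero]
  have h := integral_neg_eq_self (unitDisk.indicator f) (volume : Measure (ℝ × ℝ))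
  simp only [hodd, integral_neg] at h
  linarith

/-- the matrices `B_{n,1}` and `B_{n,2}` in the general triple
recursion relation vanish for this basis. -/
theorem B_ni_zero (n i j : ℕ) (hi : i ≤ n) (hj : j ≤ n) :
    (∫ p in unitDisk, p.1 * Q2 n i p.1 p.2 * Q2 n j p.1 p.2) = 0 ∧
    (∫ p in unitDisk, p.2 * Q2 n i p.1 p.2 * Q2 n j p.1 p.2) = 0 := by
  constructor <;> refine setIntegral_unitDisk_eq_zero_of_odd fun p => ?_
  · simp only [Prod.fst_neg, Prod.snd_neg, mul_assoc, Q2_mul_Q2_neg_neg hi hj, neg_mul]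
  · simp only [Prod.fst_neg, Prod.snd_neg, mul_assoc, Q2_mul_Q2_neg_neg hi hj, neg_mul]
end
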